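/- Let $G$ be an affine algebraic group scheme of finite type over a field $k$. There exists a unipotent normal closed subgroup scheme $\mathrm{Rad}_u(G)$ of $G$ which contains every unipotent normal closed subgroup scheme of $G$. -/

import Mathlib

/- # Preliminaries: affine group schemes via commutative Hopf algebras

An affine algebraic group scheme `G` over a field `k` is encoded by its coordinate
Hopf algebra `A = O(G)` (a commutative Hopf `k`-algebra of finite type).  The group
of `R`-points is `G(R) = Hom_{k-alg}(A, R)`, with multiplication given by
convolution through the comultiplication.  Closed subgroup schemes are encoded by
surjective maps of Hopf algebras `A →ₐc[k] B`. -/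

open TensorProduct

noncomputable section

/-- The product of two `R`-points of the affine group scheme `Spec A`,
given by convolution through the comultiplication of `A`. -/
def ptMul {k A R : Type} [CommRing k] [CommRing A] [Bialgebra k A]
    [CommRing R] [Algebra k R] (f g : A →ₐ[k] R) : A →ₐ[k] R :=
  (Algebra.TensorProduct.productMap f g).comp (Bialgebra.comulAlgHom k A)

/-- The identity `R`-point of the affine group scheme `Spec A`. -/
def ptOne {k A : Type} [CommRing k] [CommRing A] [Bialgebra k A]
    (R : Type) [CommRing R] [Algebra k R] : A →ₐ[k] R :=
  (Algebra.ofId k R).comp (Bialgebra.counitAlgHom k A)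

/-- A closed subgroup scheme of the affine group scheme `Spec A`, encoded by a
surjection of commutative Hopf algebras `π : A → B`; the subgroup is `Spec B`. -/
structure ClosedSubgrp (k A : Type) [CommRing k] [CommRing A] [HopfAlgebra k A] where
  B : Type
  [commRing : CommRing B]
  [hopf : HopfAlgebra k B]
  π : A →ₐc[k] B
  surj : Function.Surjective π

attribute [instance] ClosedSubgrp.commRing ClosedSubgrp.hopf

namespace ClosedSubgrp

variable {k A : Type} [CommRing k] [CommRing A] [HopfAlgebra k A]

/-- An `R`-point of `Spec A` lies in the closed subgroup iff it factors through `π`. -/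
def mem (H : ClosedSubgrp k A) {R : Type} [CommRing R] [Algebra k R]
    (f : A →ₐ[k] R) : Prop :=
  ∃ g : H.B →ₐ[k] R, f = g.comp (H.π : A →ₐ[k] H.B)

/-- Containment of closed subgroup schemes, tested on points. -/
def le (H H' : ClosedSubgrp k A) : Prop :=
  ∀ (R : Type) [CommRing R] [Algebra k R], ∀ f : A →ₐ[k] R, H.mem f → H'.mem f

/-- Normality of a closed subgroup scheme, tested on points:
for every `g ∈ G(R)` and `f ∈ H(R)` the conjugate `g f g⁻¹` lies in `H(R)`
(phrased multiplicatively: `g * f = f' * g` for some `f' ∈ H(R)`). -/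
def Normal (H : ClosedSubgrp k A) : Prop :=
  ∀ (R : Type) [CommRing R] [Algebra k R], ∀ f g : A →ₐ[k] R,
    H.mem f → ∃ f' : A →ₐ[k] R, H.mem f' ∧ ptMul g f = ptMul f' g

/-- The closed subgroup scheme is trivial: all its points are the identity. -/
def Trivial (H : ClosedSubgrp k A) : Prop :=
  ∀ (R : Type) [CommRing R] [Algebra k R], ∀ f : A →ₐ[k] R, H.mem f → f = ptOne R

end ClosedSubgrp

/-- A (right) comodule structure on `V` over the coalgebra underlying `B`;
equivalently, a linear representation of the affine group scheme `Spec B`. -/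
structure Coaction (k B V : Type) [CommRing k] [CommRing B] [Bialgebra k B]
    [AddCommGroup V] [Module k V] where
  ρ : V →ₗ[k] V ⊗[k] B
  counit_law : ∀ v : V,
    TensorProduct.rid k V (LinearMap.lTensor V (Coalgebra.counit (R := k) (A := B)) (ρ v)) = v
  coassoc : ∀ v : V, LinearMap.rTensor B ρ (ρ v)
      = (TensorProduct.assoc k V B B).symm
          (LinearMap.lTensor V (Coalgebra.comul (R := k) (A := B)) (ρ v))

/-- The affine group scheme `Spec B` is unipotent: every nonzero finite-dimensional
linear representation has a nonzero fixed vector. -/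
def IsUnipotentHopf (k B : Type) [CommRing k] [CommRing B] [HopfAlgebra k B] : Prop :=
  ∀ (V : Type) [AddCommGroup V] [Module k V] [Module.Finite k V],
    ∀ c : Coaction k B V, Nontrivial V → ∃ v : V, v ≠ 0 ∧ c.ρ v = v ⊗ₜ[k] (1 : B)

/-- `U` is the restricted unipotent radical of `Spec A`: a unipotent normal closed
subgroup scheme containing every unipotent normal closed subgroup scheme. -/
def IsRadU {k A : Type} [CommRing k] [CommRing A] [HopfAlgebra k A]
    (U : ClosedSubgrp k A) : Prop :=
  U.Normal ∧ IsUnipotentHopf k U.B ∧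
    ∀ H : ClosedSubgrp k A, H.Normal → IsUnipotentHopf k H.B → H.le U

/-- The affine group scheme `Spec A` is commutative. -/
def IsCommutativeHopf (k A : Type) [CommRing k] [CommRing A] [Bialgebra k A] : Prop :=
  ∀ (R : Type) [CommRing R] [Algebra k R], ∀ f g : A →ₐ[k] R, ptMul f g = ptMul g f


section Convolution

variable {k C M R R' : Type} [Field k] [AddCommGroup C] [Module k C] [AddCommGroup M] [Module k M]
  [CommRing R] [Algebra k R] [CommRing R'] [Algebra k R']

/-- A `k`-valued linear form, regarded as an `R`-valued one. -/
def scalarExt (R : Type) [CommRing R] [Algebra k R] (φ : C →ₗ[k] k) : C →ₗ[k] R :=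
  Algebra.linearMap k R ∘ₗ φ

@[simp]
lemma scalarExt_apply (φ : C →ₗ[k] k) (x : C) : scalarExt R φ x = algebraMap k R (φ x) := rfl

lemma comp_scalarExt (h : R →ₐ[k] R') (φ : C →ₗ[k] k) :
    h.toLinearMap ∘ₗ scalarExt R φ = scalarExt R' φ := by
  ext; simp

lemma Submodule.mem_of_forall_dual {W : Submodule k C} {x : C}
    (h : ∀ φ : C →ₗ[k] k, (∀ w ∈ W, φ w = 0) → φ x = 0) : x ∈ W := by
  by_contra hx
  obtain ⟨φ, hφ, hW⟩ := Submodule.exists_le_ker_of_notMem hx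
  exact hφ (h φ fun w hw ↦ hW hw)

/-- A tensor all of whose left coefficients lie in `W` comes from `W ⊗ M`. -/
lemma mem_range_rTensor_subtype_of_rid_mem {W : Submodule k C} {t : C ⊗[k] M}
    (h : ∀ ψ : M →ₗ[k] k, TensorProduct.rid k C (ψ.lTensor C t) ∈ W) :
    t ∈ LinearMap.range (W.subtype.rTensor M) := by
  classical
  let b := Module.Basis.ofVectorSpace k M
  rw [← (TensorProduct.equivFinsuppOfBasisRight b).symm_apply_apply t,
    TensorProduct.equivFinsuppOfBasisRight_symm_apply]
  refine Submodule.sum_mem _ fun i _ ↦ ?_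
  rw [TensorProduct.equivFinsuppOfBasisRight_apply]
  exact ⟨⟨_, h (b.coord i)⟩ ⊗ₜ b i, rfl⟩

lemma lid_rTensor_rid_lTensor (φ : C →ₗ[k] k) (ψ : M →ₗ[k] k) (t : C ⊗[k] M) :
    φ (TensorProduct.rid k C (ψ.lTensor C t)) = ψ (TensorProduct.lid k M (φ.rTensor M t)) := by
  induction t with
  | zero => simp
  | add x y hx hy => simp [hx, hy]
  | tmul x y => simp [mul_comm]

lemma mem_range_rTensor_subtype_of_rTensor_eq_zero {W : Submodule k C} {t : C ⊗[k] M}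
    (h : ∀ φ : C →ₗ[k] k, (∀ w ∈ W, φ w = 0) → φ.rTensor M t = 0) :
    t ∈ LinearMap.range (W.subtype.rTensor M) :=
  mem_range_rTensor_subtype_of_rid_mem fun ψ ↦ Submodule.mem_of_forall_dual fun φ hφ ↦ by
    rw [lid_rTensor_rid_lTensor, h φ hφ, map_zero, map_zero]

variable [Coalgebra k C]

/-- The convolution product of two linear maps from a coalgebra to an algebra. -/
def conv (f g : C →ₗ[k] R) : C →ₗ[k] R :=
  (WithConv.toConv f * WithConv.toConv g).ofConv

lemma conv_apply (f g : C →ₗ[k] R) (x : C) :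
    conv f g x = LinearMap.mul' k R (TensorProduct.map f g (Coalgebra.comul x)) := rfl

lemma conv_assoc (f g h : C →ₗ[k] R) : conv (conv f g) h = conv f (conv g h) :=
  congrArg WithConv.ofConv (mul_assoc (WithConv.toConv f) (WithConv.toConv g) (WithConv.toConv h))

lemma conv_counit (f : C →ₗ[k] R) : conv f (scalarExt R Coalgebra.counit) = f :=
  congrArg WithConv.ofConv (mul_one (WithConv.toConv f))

lemma comp_conv (h : R →ₐ[k] R') (f g : C →ₗ[k] R) :
    h.toLinearMap ∘ₗ conv f g = conv (h.toLinearMap ∘ₗ f) (h.toLinearMap ∘ₗ g) :=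
  LinearMap.algHom_comp_convMul_distrib h _ _

/-- The action of a linear form `ψ` on a coalgebra by `x ↦ ∑ x₁ ψ(x₂)`. -/
def dualAct (ψ : C →ₗ[k] k) : C →ₗ[k] C :=
  (TensorProduct.rid k C).toLinearMap ∘ₗ ψ.lTensor C ∘ₗ Coalgebra.comul

lemma dualAct_apply (ψ : C →ₗ[k] k) (x : C) :
    dualAct ψ x = TensorProduct.rid k C (ψ.lTensor C (Coalgebra.comul x)) := rfl

lemma conv_scalarExt (Φ : C →ₗ[k] R) (ψ : C →ₗ[k] k) (x : C) :
    conv Φ (scalarExt R ψ) x = Φ (dualAct ψ x) := by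
  rw [conv_apply, dualAct_apply]
  induction (Coalgebra.comul x : C ⊗[k] C) with
  | zero => simp
  | add x y hx hy => simp only [map_add, hx, hy]
  | tmul x y => simp [Algebra.smul_def, mul_comm]

lemma conv_dual (φ ψ : C →ₗ[k] k) (x : C) : conv φ ψ x = φ (dualAct ψ x) :=
  conv_scalarExt φ ψ x

lemma dualAct_dualAct (χ ψ : C →ₗ[k] k) (x : C) :
    dualAct χ (dualAct ψ x) = dualAct (conv χ ψ) x := by
  rw [← sub_eq_zero, ← Submodule.mem_bot k]
  refine Submodule.mem_of_forall_dual fun φ _ ↦ ?_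
  rw [map_sub, ← conv_dual, ← conv_dual, ← conv_dual, conv_assoc, sub_self]

lemma dualAct_counit (x : C) : dualAct (Coalgebra.counit (R := k)) x = x := by
  simp [dualAct_apply]

lemma map_conv_scalarExt (ψ : R →ₗ[k] k) (φ : C →ₗ[k] k) (f : C →ₗ[k] R) (x : C) :
    ψ (conv (scalarExt R φ) f x) = conv φ (ψ ∘ₗ f) x := by
  rw [conv_apply, conv_apply]
  induction (Coalgebra.comul x : C ⊗[k] C) with
  | zero => simp
  | add x y hx hy => simp only [map_add, hx, hy]
  | tmul x y => simp [← Algebra.smul_def]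

/-- A subspace `W` of a coalgebra is a right subcomodule, in terms of the action of the dual. -/
def IsSubcomodule (W : Submodule k C) : Prop :=
  ∀ (ψ : C →ₗ[k] k), ∀ w ∈ W, dualAct ψ w ∈ W

lemma IsSubcomodule.comul_mem {W : Submodule k C} (hW : IsSubcomodule W) {w : C} (hw : w ∈ W) :
    Coalgebra.comul w ∈ LinearMap.range (W.subtype.rTensor C) :=
  mem_range_rTensor_subtype_of_rid_mem fun ψ ↦ hW ψ w hw

lemma IsSubcomodule.map_comul_eq {N P : Type} [AddCommGroup N] [Module k N] [AddCommGroup P]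
    [Module k P] {W : Submodule k C} (hW : IsSubcomodule W) {Φ Ψ : C →ₗ[k] N} (f : C →ₗ[k] P)
    (h : ∀ w ∈ W, Φ w = Ψ w) {w : C} (hw : w ∈ W) :
    TensorProduct.map Φ f (Coalgebra.comul w) = TensorProduct.map Ψ f (Coalgebra.comul w) := by
  obtain ⟨t, ht⟩ := hW.comul_mem hw
  have : Φ ∘ₗ W.subtype = Ψ ∘ₗ W.subtype := by ext x; exact h x x.2
  rw [← ht, LinearMap.rTensor, TensorProduct.map_map, TensorProduct.map_map, this]

lemma IsSubcomodule.conv_congr {W : Submodule k C} (hW : IsSubcomodule W) {Φ Ψ : C →ₗ[k] R}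
    (f : C →ₗ[k] R) (h : ∀ w ∈ W, Φ w = Ψ w) {w : C} (hw : w ∈ W) : conv Φ f w = conv Ψ f w := by
  rw [conv_apply, conv_apply, hW.map_comul_eq f h hw]

lemma exists_isSubcomodule_mem (x : C) :
    ∃ W : Submodule k C, IsSubcomodule W ∧ Module.Finite k W ∧ x ∈ W := by
  let L : (C →ₗ[k] k) →ₗ[k] C := (TensorProduct.rid k C).toLinearMap ∘ₗ
    LinearMap.applyₗ (Coalgebra.comul x : C ⊗[k] C) ∘ₗ LinearMap.lTensorHom C
  have hL ψ : L ψ = dualAct ψ x := rfl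
  refine ⟨LinearMap.range L, ?_, ?_, Coalgebra.counit, dualAct_counit x⟩
  · rintro χ _ ⟨ψ, rfl⟩
    exact ⟨conv χ ψ, by rw [hL, hL, dualAct_dualAct]⟩
  · let r := Coalgebra.Repr.arbitrary k x
    have : LinearMap.range L ≤ Submodule.span k (r.left '' r.index) := by
      rintro _ ⟨ψ, rfl⟩
      rw [hL, dualAct_apply, ← r.eq]
      simp only [map_sum, LinearMap.lTensor_tmul, TensorProduct.rid_tmul]
      exact Submodule.sum_mem _ fun i hi ↦ Submodule.smul_mem _ _
        (Submodule.subset_span ⟨i, hi, rfl⟩)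
    have := FiniteDimensional.span_of_finite k (r.index.finite_toSet.image r.left)
    exact Submodule.finiteDimensional_of_le ‹LinearMap.range L ≤ _›

end Convolution
section FixesQuotient

variable {k C R R' : Type} [Field k] [AddCommGroup C] [Module k C] [Coalgebra k C]
  [CommRing R] [Algebra k R] [CommRing R'] [Algebra k R'] {W' W : Submodule k C}

/-- The `R`-linear endomorphism of `C ⊗ R` induced by `f` moves `w` by an element of `W' ⊗ R`,
as tested on the linear forms which vanish on `W'`. -/
def FixesMod (W' : Submodule k C) (f : C →ₗ[k] R) (w : C) : Prop :=
  ∀ φ : C →ₗ[k] k, (∀ x ∈ W', φ x = 0) → conv (scalarExt R φ) f w = algebraMap k R (φ w)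

lemma FixesMod.comp {f : C →ₗ[k] R} {w : C} (hf : FixesMod W' f w) (h : R →ₐ[k] R') :
    FixesMod W' (h.toLinearMap ∘ₗ f) w := by
  intro φ hφ
  rw [← comp_scalarExt h, ← comp_conv]
  simp [hf φ hφ]

lemma FixesMod.conv_eq {f : C →ₗ[k] R} {w : C} (hf : FixesMod W' f w) {Φ : C →ₗ[k] R}
    (hΦ : ∀ x ∈ W', Φ x = 0) : conv Φ f w = Φ w := by
  have key : f.lTensor C (Coalgebra.comul w) - w ⊗ₜ[k] (1 : R) ∈
      LinearMap.range (W'.subtype.rTensor R) := by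
    refine mem_range_rTensor_subtype_of_rTensor_eq_zero fun φ hφ ↦ ?_
    apply (TensorProduct.lid k R).injective
    have h1 : TensorProduct.lid k R (φ.rTensor R (f.lTensor C (Coalgebra.comul w))) =
        conv (scalarExt R φ) f w := by
      rw [conv_apply]
      induction (Coalgebra.comul w : C ⊗[k] C) with
      | zero => simp
      | add x y hx hy => simp only [map_add, hx, hy]
      | tmul x y => simp [← Algebra.smul_def]
    rw [map_sub, map_sub, h1, hf φ hφ]
    simp [Algebra.algebraMap_eq_smul_one]
  obtain ⟨t, ht⟩ := key
  have h0 : LinearMap.mul' k R (Φ.rTensor R (W'.subtype.rTensor R t)) = 0 := by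
    have : Φ ∘ₗ W'.subtype = 0 := by ext x; exact hΦ x x.2
    rw [← LinearMap.rTensor_comp_apply, this]
    simp
  rw [ht, map_sub, map_sub, ← LinearMap.comp_apply (Φ.rTensor R), LinearMap.rTensor_comp_lTensor,
    ← conv_apply, sub_eq_zero] at h0
  simpa using h0

/-- `W' < W` are subcomodules with `W` finite-dimensional and `W / W'` simple. -/
structure IsSimpleSubquotient (W' W : Submodule k C) : Prop where
  left : IsSubcomodule W'
  right : IsSubcomodule W
  finite : Module.Finite k W
  lt : W' < W
  eq_or_eq : ∀ X : Submodule k C, IsSubcomodule X → W' ≤ X → X ≤ W → X = W' ∨ X = W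

/-- The map `f` acts trivially on all simple subquotients of the regular comodule. -/
def ActsTrivially (f : C →ₗ[k] R) : Prop :=
  ∀ W' W : Submodule k C, IsSimpleSubquotient W' W → ∀ w ∈ W, FixesMod W' f w

lemma ActsTrivially.comp {f : C →ₗ[k] R} (hf : ActsTrivially f) (h : R →ₐ[k] R') :
    ActsTrivially (h.toLinearMap ∘ₗ f) :=
  fun W' W hW w hw ↦ (hf W' W hW w hw).comp h

lemma actsTrivially_counit : ActsTrivially (scalarExt R (Coalgebra.counit (R := k) (A := C))) := by
  intro W' W _ w _ φ _
  rw [conv_counit, scalarExt_apply]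

lemma ActsTrivially.conv {f g : C →ₗ[k] R} (hf : ActsTrivially f) (hg : ActsTrivially g) :
    ActsTrivially (conv f g) := by
  intro W' W hW w hw φ hφ
  rw [← conv_assoc, hW.right.conv_congr (Ψ := scalarExt R φ) g (fun x hx ↦ hf W' W hW x hx φ hφ) hw]
  exact hg W' W hW w hw φ hφ

lemma ActsTrivially.of_conv_eq {f g : C →ₗ[k] R} (hf : ActsTrivially f)
    (hfg : _root_.conv f g = scalarExt R Coalgebra.counit) : ActsTrivially g := by
  intro W' W hW w hw φ hφ
  have h := hW.right.conv_congr (Ψ := scalarExt R φ) g (fun x hx ↦ hf W' W hW x hx φ hφ) hw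
  rw [conv_assoc, hfg, conv_counit] at h
  exact h.symm

/-- Conjugation preserves the property of acting trivially. -/
lemma ActsTrivially.conj {f g h : C →ₗ[k] R} (hf : ActsTrivially f)
    (hgh : _root_.conv g h = scalarExt R Coalgebra.counit) :
    ActsTrivially (_root_.conv (_root_.conv g f) h) := by
  intro W' W hW w hw φ hφ
  have h0 : ∀ x ∈ W', _root_.conv (scalarExt R φ) g x = 0 := by
    intro x hx
    rw [hW.left.conv_congr (Ψ := 0) g (fun y hy ↦ by simp [hφ y hy]) hx, conv_apply]
    simp
  have h1 := hW.right.conv_congr h (fun x hx ↦ (hf W' W hW x hx).conv_eq h0) hw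
  rw [conv_assoc, conv_assoc, conv_assoc, hgh, conv_counit] at h1
  rw [conv_assoc, h1, scalarExt_apply]

end FixesQuotient

section Radical

variable (k A : Type) [Field k] [CommRing A] [HopfAlgebra k A]

/-- The ideal of the largest subgroup acting trivially on all simple representations. -/
def radIdeal : Ideal A :=
  Ideal.span {a | ∃ W' W : Submodule k A, IsSimpleSubquotient W' W ∧ ∃ w ∈ W,
    ∃ φ : A →ₗ[k] k, (∀ x ∈ W', φ x = 0) ∧
      a = conv (scalarExt A φ) LinearMap.id w - algebraMap k A (φ w)}

variable {k A} {R : Type} [CommRing R] [Algebra k R]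

lemma actsTrivially_iff_radIdeal_le_ker (f : A →ₐ[k] R) :
    ActsTrivially f.toLinearMap ↔ radIdeal k A ≤ RingHom.ker f := by
  have key (φ : A →ₗ[k] k) (w : A) :
      f (conv (scalarExt A φ) LinearMap.id w - algebraMap k A (φ w)) =
        conv (scalarExt R φ) f.toLinearMap w - algebraMap k R (φ w) := by
    rw [map_sub, ← comp_scalarExt f]
    congr 1
    · exact LinearMap.congr_fun (comp_conv f (scalarExt A φ) LinearMap.id) w
    · simp
  rw [radIdeal, Ideal.span_le]
  constructor
  · rintro hf _ ⟨W', W, hW, w, hw, φ, hφ, rfl⟩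
    exact (key φ w).trans (sub_eq_zero.2 (hf W' W hW w hw φ hφ))
  · intro hf W' W hW w hw φ hφ
    rw [← sub_eq_zero, ← key]
    exact hf ⟨W', W, hW, w, hw, φ, hφ, rfl⟩

lemma ActsTrivially.apply_eq_zero {f : A →ₐ[k] R} (hf : ActsTrivially f.toLinearMap) {x : A}
    (hx : x ∈ radIdeal k A) : f x = 0 :=
  (actsTrivially_iff_radIdeal_le_ker f).1 hf hx

lemma comp_ofConv_one (f : A →ₐ[k] R) :
    f.toLinearMap ∘ₗ (1 : WithConv (A →ₗ[k] A)).ofConv = (1 : WithConv (A →ₗ[k] R)).ofConv := by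
  ext; simp

lemma toConv_mul_antipode (f : A →ₐ[k] R) : WithConv.toConv f *
    WithConv.toConv (f.comp (HopfAlgebra.antipodeAlgHom k A)) = 1 := by
  have h := LinearMap.algHom_comp_convMul_distrib f
    (WithConv.toConv LinearMap.id) (WithConv.toConv (HopfAlgebra.antipode k (A := A)))
  rw [LinearMap.id_mul_antipode, comp_ofConv_one] at h
  exact WithConv.ofConv_injective (AlgHom.toLinearMap_injective h.symm)

lemma antipode_mul_toConv (f : A →ₐ[k] R) :
    WithConv.toConv (f.comp (HopfAlgebra.antipodeAlgHom k A)) * WithConv.toConv f = 1 := by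
  have h := LinearMap.algHom_comp_convMul_distrib f
    (WithConv.toConv (HopfAlgebra.antipode k (A := A))) (WithConv.toConv LinearMap.id)
  rw [LinearMap.antipode_mul_id, comp_ofConv_one] at h
  exact WithConv.ofConv_injective (AlgHom.toLinearMap_injective h.symm)

lemma conv_antipode (f : A →ₐ[k] R) :
    conv f.toLinearMap (f.comp (HopfAlgebra.antipodeAlgHom k A)).toLinearMap =
      scalarExt R Coalgebra.counit :=
  congrArg (fun g : WithConv (A →ₐ[k] R) ↦ g.ofConv.toLinearMap) (toConv_mul_antipode f)

lemma actsTrivially_mk : ActsTrivially (Ideal.Quotient.mkₐ k (radIdeal k A)).toLinearMap := by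
  rw [actsTrivially_iff_radIdeal_le_ker]
  exact (Ideal.Quotient.mkₐ_ker k _).ge

lemma ActsTrivially.map_comul_eq_zero {q : A →ₐ[k] R} (hq : ActsTrivially q.toLinearMap) {x : A}
    (hx : x ∈ radIdeal k A) :
    TensorProduct.map q.toLinearMap q.toLinearMap (Coalgebra.comul x) = 0 := by
  have hfg := (hq.comp Algebra.TensorProduct.includeLeft).conv
    (hq.comp (Algebra.TensorProduct.includeRight : R →ₐ[k] R ⊗[k] R))
  have h0 := ActsTrivially.apply_eq_zero (f := (WithConv.toConv
    ((Algebra.TensorProduct.includeLeft : R →ₐ[k] R ⊗[k] R).comp q) * WithConv.toConv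
    ((Algebra.TensorProduct.includeRight : R →ₐ[k] R ⊗[k] R).comp q)).ofConv) hfg hx
  rw [← h0, AlgHom.convMul_apply]
  generalize (Coalgebra.comul x : A ⊗[k] A) = t
  induction t with
  | zero => simp only [map_zero]
  | add x y hx hy => simp only [map_add, hx, hy]
  | tmul x y => simp

lemma antipode_mem_radIdeal {x : A} (hx : x ∈ radIdeal k A) :
    HopfAlgebra.antipode k x ∈ radIdeal k A := by
  have h := actsTrivially_mk.of_conv_eq (conv_antipode (Ideal.Quotient.mkₐ k (radIdeal k A)))
  exact Ideal.Quotient.eq_zero_iff_mem.1 (h.apply_eq_zero hx)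

lemma counit_eq_zero_of_mem_radIdeal {x : A} (hx : x ∈ radIdeal k A) :
    Coalgebra.counit (R := k) x = 0 := by
  have h : ActsTrivially (Bialgebra.counitAlgHom k A).toLinearMap :=
    actsTrivially_counit (R := k)
  exact h.apply_eq_zero hx

instance : (radIdeal k A).IsHopfIdeal k where
  counit_eq_zero _ hx := counit_eq_zero_of_mem_radIdeal hx
  map_mkQ_comul_eq_zero _ hx := actsTrivially_mk.map_comul_eq_zero hx
  antipode_mem _ hx := antipode_mem_radIdeal hx

variable (k A) in
/-- The subgroup acting trivially on all simple representations. -/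
def radSubgrp : ClosedSubgrp k A where
  B := A ⧸ radIdeal k A
  π := Bialgebra.Quotient.mkBialgHom (radIdeal k A)
  surj := Ideal.Quotient.mk_surjective

lemma radSubgrp_mem_iff (f : A →ₐ[k] R) :
    (radSubgrp k A).mem f ↔ ActsTrivially f.toLinearMap := by
  constructor
  · rintro ⟨g, rfl⟩
    exact actsTrivially_mk.comp g
  · intro hf
    exact ⟨Ideal.Quotient.liftₐ _ f ((actsTrivially_iff_radIdeal_le_ker f).1 hf), rfl⟩

lemma ptMul_eq (f g : A →ₐ[k] R) :
    ptMul f g = (WithConv.toConv f * WithConv.toConv g).ofConv := by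
  rw [ptMul, AlgHom.convMul_def, Algebra.TensorProduct.productMap_eq_comp_map]
  rfl

lemma radSubgrp_normal : (radSubgrp k A).Normal := by
  intro R _ _ f g hf
  rw [radSubgrp_mem_iff] at hf
  let f' : WithConv (A →ₐ[k] R) := .toConv f
  let g' : WithConv (A →ₐ[k] R) := .toConv g
  let h' : WithConv (A →ₐ[k] R) := .toConv (g.comp (HopfAlgebra.antipodeAlgHom k A))
  refine ⟨(g' * f' * h').ofConv, (radSubgrp_mem_iff _).2 (hf.conj (conv_antipode g)), ?_⟩
  rw [ptMul_eq, ptMul_eq, WithConv.toConv_ofConv, mul_assoc (g' * f'), antipode_mul_toConv, mul_one]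

end Radical

section Unipotent

variable {k : Type} [Field k]

section Coalgebra

variable {C : Type} [AddCommGroup C] [Module k C] [Coalgebra k C]

/-- The ascending filtration of a coalgebra whose successive quotients are annihilated by the
linear forms in `J`. -/
def annFiltration (J : Set (C →ₗ[k] k)) : ℕ → Submodule k C
  | 0 => ⊥
  | n + 1 => ⨅ ψ ∈ J, (annFiltration J n).comap (dualAct ψ)

lemma mem_annFiltration_succ {J : Set (C →ₗ[k] k)} {n : ℕ} {x : C} :
    x ∈ annFiltration J (n + 1) ↔ ∀ ψ ∈ J, dualAct ψ x ∈ annFiltration J n := by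
  simp [annFiltration]

lemma annFiltration_mono (J : Set (C →ₗ[k] k)) : Monotone (annFiltration J) := by
  refine monotone_nat_of_le_succ fun n ↦ ?_
  induction n with
  | zero => exact bot_le
  | succ n ih =>
    exact fun x hx ↦ mem_annFiltration_succ.2 fun ψ hψ ↦ ih (mem_annFiltration_succ.1 hx ψ hψ)

lemma exists_isSimpleSubquotient {W : Submodule k C} (hW : IsSubcomodule W)
    (hfin : Module.Finite k W) (hne : W ≠ ⊥) : ∃ W', IsSimpleSubquotient W' W := by
  let S : Set (Submodule k C) := {X | IsSubcomodule X ∧ X < W}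
  have hS : S.Nonempty := ⟨⊥, fun ψ w hw ↦ by simp_all, bot_lt_iff_ne_bot.2 hne⟩
  obtain ⟨X, hX, hmin⟩ := exists_minimalFor_of_wellFoundedLT (· ∈ S)
    (fun X ↦ Module.finrank k W - Module.finrank k X) hS
  refine ⟨X, hX.1, hW, hfin, hX.2, fun Y hY hXY hYW ↦ ?_⟩
  by_contra! h
  have hYlt : Y < W := lt_of_le_of_ne hYW h.2
  have hle := hmin ⟨hY, hYlt⟩
  simp only at hle
  have : Module.Finite k Y := Submodule.finiteDimensional_of_le hYW
  have h1 := Submodule.finrank_lt_finrank_of_lt (lt_of_le_of_ne hXY h.1.symm)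
  have h2 := Submodule.finrank_lt_finrank_of_lt hYlt
  omega

lemma exists_le_annFiltration {J : Set (C →ₗ[k] k)}
    (hJ : ∀ W' W : Submodule k C, IsSimpleSubquotient W' W → ∀ ψ ∈ J, ∀ w ∈ W, dualAct ψ w ∈ W')
    {W : Submodule k C} (hW : IsSubcomodule W) (hfin : Module.Finite k W) :
    ∃ n, W ≤ annFiltration J n := by
  induction hd : Module.finrank k W using Nat.strong_induction_on generalizing W with
  | _ d ih =>
    by_cases hne : W = ⊥
    · exact ⟨0, hne.le⟩
    obtain ⟨W', h⟩ := exists_isSimpleSubquotient hW hfin hne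
    obtain ⟨n, hn⟩ := ih _ (hd ▸ Submodule.finrank_lt_finrank_of_lt h.lt) h.left
      (Submodule.finiteDimensional_of_le h.lt.le) rfl
    exact ⟨n + 1, fun w hw ↦ mem_annFiltration_succ.2 fun ψ hψ ↦ hn (hJ W' W h ψ hψ w hw)⟩

lemma exists_mem_annFiltration {J : Set (C →ₗ[k] k)}
    (hJ : ∀ W' W : Submodule k C, IsSimpleSubquotient W' W → ∀ ψ ∈ J, ∀ w ∈ W, dualAct ψ w ∈ W')
    (x : C) : ∃ n, x ∈ annFiltration J n := by
  obtain ⟨W, hW, hfin, hx⟩ := exists_isSubcomodule_mem x (k := k)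
  obtain ⟨n, hn⟩ := exists_le_annFiltration hJ hW hfin
  exact ⟨n, hn hx⟩

end Coalgebra

section Coefficients

variable {B V : Type} [CommRing B] [Bialgebra k B] [AddCommGroup V] [Module k V]

/-- The matrix coefficient of a comodule attached to a linear form and a vector. -/
def Coaction.coeff (c : Coaction k B V) (φ : V →ₗ[k] k) (v : V) : B :=
  TensorProduct.lid k B (φ.rTensor B (c.ρ v))

/-- The action of a linear form on a comodule. -/
def Coaction.act (c : Coaction k B V) (χ : B →ₗ[k] k) (v : V) : V :=
  TensorProduct.rid k V (χ.lTensor V (c.ρ v))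

lemma Coaction.counit_coeff (c : Coaction k B V) (φ : V →ₗ[k] k) (v : V) :
    Coalgebra.counit (R := k) (c.coeff φ v) = φ v := by
  rw [Coaction.coeff, ← lid_rTensor_rid_lTensor, c.counit_law]

lemma Coaction.coeff_act (c : Coaction k B V) (φ : V →ₗ[k] k) (χ : B →ₗ[k] k) (v : V) :
    c.coeff φ (c.act χ v) = dualAct χ (c.coeff φ v) := by
  have h := congrArg (fun t ↦ TensorProduct.rid k B (χ.lTensor B
    (((TensorProduct.lid k B).toLinearMap ∘ₗ φ.rTensor B).rTensor B t))) (c.coassoc v)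
  have h1 (t : V ⊗[k] B) : TensorProduct.rid k B (χ.lTensor B
      (((TensorProduct.lid k B).toLinearMap ∘ₗ φ.rTensor B).rTensor B (c.ρ.rTensor B t))) =
      TensorProduct.lid k B (φ.rTensor B (c.ρ (TensorProduct.rid k V (χ.lTensor V t)))) := by
    induction t with
    | zero => simp
    | add x y hx hy => simp only [map_add, hx, hy]
    | tmul x y => simp
  have h2 (t : V ⊗[k] B) : TensorProduct.rid k B (χ.lTensor B
      (((TensorProduct.lid k B).toLinearMap ∘ₗ φ.rTensor B).rTensor B
        ((TensorProduct.assoc k V B B).symm ((Coalgebra.comul (R := k)).lTensor V t)))) =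
      dualAct χ (TensorProduct.lid k B (φ.rTensor B t)) := by
    induction t with
    | zero => simp
    | add x y hx hy => simp only [map_add, hx, hy]
    | tmul x b =>
      simp only [LinearMap.lTensor_tmul, LinearMap.rTensor_tmul, TensorProduct.lid_tmul, map_smul,
        dualAct_apply]
      induction (Coalgebra.comul b : B ⊗[k] B) with
      | zero => simp
      | add x y hx hy => simp only [map_add, TensorProduct.tmul_add, smul_add, hx, hy]
      | tmul y z => simp [smul_smul, mul_comm]
  rw [h1, h2] at h
  exact h

lemma Coaction.eq_tmul_one_of_act_eq_zero (c : Coaction k B V) {v : V}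
    (h : ∀ χ : B →ₗ[k] k, χ 1 = 0 → c.act χ v = 0) : c.ρ v = v ⊗ₜ[k] (1 : B) := by
  have hχ (χ : B →ₗ[k] k) : TensorProduct.rid k V (χ.lTensor V (c.ρ v - v ⊗ₜ[k] (1 : B))) ∈
      (⊥ : Submodule k V) := by
    have h1 := h (χ - χ 1 • Coalgebra.counit) (by simp)
    rw [Coaction.act, LinearMap.lTensor_sub, LinearMap.lTensor_smul, LinearMap.sub_apply, map_sub,
      LinearMap.smul_apply, map_smul, c.counit_law] at h1
    simpa using h1
  obtain ⟨t, ht⟩ := mem_range_rTensor_subtype_of_rid_mem hχ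
  rw [← sub_eq_zero, ← ht, Subsingleton.elim t 0, map_zero]

end Coefficients

variable {A B : Type} [CommRing A] [HopfAlgebra k A] [CommRing B] [HopfAlgebra k B]

lemma bialgHom_dualAct (π : A →ₐc[k] B) (χ : B →ₗ[k] k) (a : A) :
    π (dualAct (χ ∘ₗ (π : A →ₐ[k] B).toLinearMap) a) = dualAct χ (π a) := by
  rw [dualAct_apply, dualAct_apply, ← CoalgHomClass.map_comp_comul_apply]
  induction (Coalgebra.comul a : A ⊗[k] A) with
  | zero => simp
  | add x y hx hy => simp only [map_add, hx, hy]
  | tmul x y => simp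

lemma dualAct_mem_of_isSimpleSubquotient {W' W : Submodule k A} (hW : IsSimpleSubquotient W' W)
    {ψ : A →ₗ[k] k} (hψ : ∀ x ∈ radIdeal k A, ψ x = 0) (h1 : ψ 1 = 0) {w : A} (hw : w ∈ W) :
    dualAct ψ w ∈ W' := by
  refine Submodule.mem_of_forall_dual fun φ hφ ↦ ?_
  have h := hψ _ (Ideal.subset_span ⟨W', W, hW, w, hw, φ, hφ, rfl⟩)
  rw [map_sub, map_conv_scalarExt, Algebra.algebraMap_eq_smul_one, map_smul, h1, smul_zero,
    sub_zero] at h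
  rw [← conv_dual]
  exact h

lemma isUnipotentHopf_of_surjective (π : A →ₐc[k] B) (hs : Function.Surjective π)
    (hπ : ∀ x ∈ radIdeal k A, π x = 0) : IsUnipotentHopf k B := by
  intro V _ _ _ c _
  by_contra! hfix
  let F := annFiltration {ψ : A →ₗ[k] k | (∀ x ∈ radIdeal k A, ψ x = 0) ∧ ψ 1 = 0}
  have hF (x : A) : ∃ n, x ∈ F n := exists_mem_annFiltration
    (fun W' W hW ψ hψ w hw ↦ dualAct_mem_of_isSimpleSubquotient hW hψ.1 hψ.2 hw) x
  have key (n : ℕ) : ∀ v : V, (∀ φ : V →ₗ[k] k, ∃ a ∈ F n, π a = c.coeff φ v) → v = 0 := by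
    induction n with
    | zero =>
      intro v hv
      refine (Module.forall_dual_apply_eq_zero_iff k v).1 fun φ ↦ ?_
      obtain ⟨a, ha, h⟩ := hv φ
      obtain rfl : a = 0 := ha
      rw [← c.counit_coeff, ← h, map_zero, map_zero]
    | succ n ih =>
      intro v hv
      by_contra hne
      refine hfix v hne (c.eq_tmul_one_of_act_eq_zero fun χ hχ ↦ ih _ fun φ ↦ ?_)
      obtain ⟨a, ha, h⟩ := hv φ
      refine ⟨_, mem_annFiltration_succ.1 ha (χ ∘ₗ (π : A →ₐ[k] B).toLinearMap)
        ⟨fun x hx ↦ ?_, ?_⟩, ?_⟩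
      · simp [hπ x hx]
      · simpa using hχ
      · rw [bialgHom_dualAct, h, c.coeff_act]
  have hcoeff (t : V ⊗[k] B) : ∃ n, ∀ φ : V →ₗ[k] k, ∃ a ∈ F n,
      π a = TensorProduct.lid k B (φ.rTensor B t) := by
    induction t with
    | zero => exact ⟨0, fun φ ↦ ⟨0, zero_mem _, by simp⟩⟩
    | add x y hx hy =>
      obtain ⟨n, hn⟩ := hx
      obtain ⟨m, hm⟩ := hy
      refine ⟨max n m, fun φ ↦ ?_⟩
      obtain ⟨a, ha, ha'⟩ := hn φ
      obtain ⟨b, hb, hb'⟩ := hm φ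
      exact ⟨a + b, add_mem (annFiltration_mono _ (le_max_left n m) ha)
        (annFiltration_mono _ (le_max_right n m) hb), by simp only [map_add, ha', hb']⟩
    | tmul v b =>
      obtain ⟨a, rfl⟩ := hs b
      obtain ⟨n, hn⟩ := hF a
      exact ⟨n, fun φ ↦ ⟨φ v • a, Submodule.smul_mem _ _ hn, by simp⟩⟩
  obtain ⟨v, hv⟩ := exists_ne (0 : V)
  obtain ⟨n, hn⟩ := hcoeff (c.ρ v)
  exact hv (key n v hn)

end Unipotent

section Maximality

variable {k A : Type} [Field k] [CommRing A] [HopfAlgebra k A]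

/-- The comodule structure over a quotient of `A` on a quotient `V` of a subcomodule `W` of `A`,
where the quotient map is the restriction to `W` of `p` and `s` is a linear section of it. -/
def subquotientCoaction {B V : Type} [CommRing B] [Bialgebra k B] [AddCommGroup V] [Module k V]
    (π : A →ₐc[k] B) (W : Submodule k A) (hW : IsSubcomodule W) (p : A →ₗ[k] V) (s : V →ₗ[k] A)
    (hs : ∀ v, s v ∈ W) (hps : ∀ v, p (s v) = v)
    (hker : IsSubcomodule (W ⊓ LinearMap.ker p)) : Coaction k B V where
  ρ := TensorProduct.map p (π : A →ₐ[k] B).toLinearMap ∘ₗ Coalgebra.comul ∘ₗ s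
  counit_law v := by
    have h (t : A ⊗[k] A) : TensorProduct.rid k V ((Coalgebra.counit (R := k) (A := B)).lTensor V
        (TensorProduct.map p (π : A →ₐ[k] B).toLinearMap t)) =
        p (TensorProduct.rid k A ((Coalgebra.counit (R := k) (A := A)).lTensor A t)) := by
      induction t with
      | zero => simp
      | add x y hx hy => simp only [map_add, hx, hy]
      | tmul x y => simp
    rw [LinearMap.comp_apply, LinearMap.comp_apply, h, ← dualAct_apply, dualAct_counit, hps]
  coassoc v := by
    set q := (π : A →ₐ[k] B).toLinearMap with hq
    have key : ∀ w ∈ W, (TensorProduct.map p q ∘ₗ Coalgebra.comul ∘ₗ s ∘ₗ p) w =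
        (TensorProduct.map p q ∘ₗ Coalgebra.comul) w := by
      intro w hw
      have h := hker.map_comul_eq (Φ := p) (Ψ := 0) q (fun x hx ↦ hx.2)
        (w := s (p w) - w) ⟨sub_mem (hs _) hw, by simp [hps]⟩
      simpa [sub_eq_zero] using h
    have h1 := hW.map_comul_eq q key (hs v)
    have h2 (t : A ⊗[k] A) : (TensorProduct.map p q ∘ₗ Coalgebra.comul ∘ₗ s).rTensor B
        (TensorProduct.map p q t) =
        TensorProduct.map (TensorProduct.map p q ∘ₗ Coalgebra.comul ∘ₗ s ∘ₗ p) q t := by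
      induction t with
      | zero => simp
      | add x y hx hy => simp only [map_add, hx, hy]
      | tmul x y => simp
    have h3 (t : A ⊗[k] A) : TensorProduct.map (TensorProduct.map p q ∘ₗ Coalgebra.comul) q t =
        TensorProduct.map (TensorProduct.map p q) q (Coalgebra.comul.rTensor A t) := by
      induction t with
      | zero => simp
      | add x y hx hy => simp only [map_add, hx, hy]
      | tmul x y => simp
    have h4 (t : A ⊗[k] A) : (Coalgebra.comul (R := k) (A := B)).lTensor V
        (TensorProduct.map p q t) =
        TensorProduct.map p (TensorProduct.map q q) (Coalgebra.comul.lTensor A t) := by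
      induction t with
      | zero => simp
      | add x y hx hy => simp only [map_add, hx, hy]
      | tmul x y =>
        have := CoalgHomClass.map_comp_comul_apply π y
        simp only [TensorProduct.map_tmul, LinearMap.lTensor_tmul]
        exact congrArg _ this.symm
    have h5 (t : A ⊗[k] (A ⊗[k] A)) : (TensorProduct.assoc k V B B).symm
        (TensorProduct.map p (TensorProduct.map q q) t) =
        TensorProduct.map (TensorProduct.map p q) q ((TensorProduct.assoc k A A A).symm t) := by
      induction t with
      | zero => simp
      | add x y hx hy => simp only [map_add, hx, hy]
      | tmul x y =>
        induction y with
        | zero => simp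
        | add y z hy hz => simp only [map_add, TensorProduct.tmul_add, hy, hz]
        | tmul y z => simp
    rw [LinearMap.comp_apply (TensorProduct.map p q), h2, LinearMap.comp_apply, h1, h3, h4, h5,
      Coalgebra.coassoc_symm_apply]

lemma exists_fixesMod_of_isUnipotentHopf {B : Type} [CommRing B] [HopfAlgebra k B]
    (hB : IsUnipotentHopf k B) (π : A →ₐc[k] B) {W' W : Submodule k A}
    (hW : IsSimpleSubquotient W' W) :
    ∃ w ∈ W, w ∉ W' ∧ FixesMod W' (π : A →ₐ[k] B).toLinearMap w := by
  let V := W ⧸ W'.comap W.subtype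
  have := hW.finite
  have hle := hW.lt.le
  obtain ⟨p, hp⟩ := LinearMap.exists_extend (W'.comap W.subtype).mkQ
  obtain ⟨s, hs⟩ := (W'.comap W.subtype).mkQ.exists_rightInverse_of_surjective
    (LinearMap.range_eq_top.2 (Submodule.mkQ_surjective _))
  have hpW (w : W) : p w = (W'.comap W.subtype).mkQ w := LinearMap.congr_fun hp w
  have hps (v : V) : p (W.subtype (s v)) = v := (hpW (s v)).trans (LinearMap.congr_fun hs v)
  have hpker (w : A) (hw : w ∈ W) : p w = 0 ↔ w ∈ W' := by
    rw [hpW ⟨w, hw⟩, Submodule.mkQ_apply, Submodule.Quotient.mk_eq_zero]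
    rfl
  have hker : W ⊓ LinearMap.ker p = W' := by
    ext x
    exact ⟨fun hx ↦ (hpker x hx.1).1 hx.2, fun hx ↦ ⟨hle hx, (hpker x (hle hx)).2 hx⟩⟩
  have hnt : Nontrivial V := by
    rw [Submodule.Quotient.nontrivial_iff]
    intro h
    rw [Submodule.comap_subtype_eq_top] at h
    exact hW.lt.not_ge h
  obtain ⟨v, hv, hfix⟩ := hB V (subquotientCoaction π W hW.right p (W.subtype ∘ₗ s)
    (fun v ↦ (s v).2) hps (hker.symm ▸ hW.left)) hnt
  have hfix : TensorProduct.map p (π : A →ₐ[k] B).toLinearMap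
    (Coalgebra.comul (s v : A)) = v ⊗ₜ[k] (1 : B) := hfix
  refine ⟨s v, (s v).2, fun h ↦ hv ?_, fun φ hφ ↦ ?_⟩
  · rw [← hps v]
    exact (hpker _ (s v).2).2 h
  · have hφp : ∀ w ∈ W, scalarExt B φ w = scalarExt B (φ ∘ₗ W.subtype ∘ₗ s ∘ₗ p) w := by
      intro w hw
      have : w - s (p w) ∈ W' := by
        rw [← hpker _ (sub_mem hw (s (p w)).2), map_sub, sub_eq_zero]
        exact (hps _).symm
      have h0 := hφ _ this
      rw [map_sub, sub_eq_zero] at h0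
      simp [h0]
    rw [hW.right.conv_congr _ hφp (s v).2, conv_apply]
    have h1 (t : A ⊗[k] A) : LinearMap.mul' k B (TensorProduct.map
        (scalarExt B (φ ∘ₗ W.subtype ∘ₗ s ∘ₗ p)) (π : A →ₐ[k] B).toLinearMap t) =
        TensorProduct.lid k B ((φ ∘ₗ W.subtype ∘ₗ s).rTensor B
          (TensorProduct.map p (π : A →ₐ[k] B).toLinearMap t)) := by
      induction t with
      | zero => simp
      | add x y hx hy => simp only [map_add, hx, hy]
      | tmul x y => simp [Algebra.smul_def]
    rw [h1, hfix]
    simp [Algebra.algebraMap_eq_smul_one]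

/-- The vectors of `W` which are fixed by `f` modulo `W'`. -/
def fixedSubmodule {R : Type} [CommRing R] [Algebra k R] (W' W : Submodule k A) (f : A →ₗ[k] R) :
    Submodule k A where
  carrier := {w | w ∈ W ∧ FixesMod W' f w}
  zero_mem' := ⟨zero_mem _, fun φ _ ↦ by simp⟩
  add_mem' hx hy := ⟨add_mem hx.1 hy.1, fun φ hφ ↦ by
    rw [map_add, map_add, map_add, hx.2 φ hφ, hy.2 φ hφ]⟩
  smul_mem' c x hx := ⟨W.smul_mem c hx.1, fun φ hφ ↦ by
    rw [map_smul, map_smul, hx.2 φ hφ, smul_eq_mul, map_mul, Algebra.smul_def]⟩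

lemma rid_lTensor_conv {B : Type} [CommRing B] [Algebra k B] (Φ : A →ₗ[k] B) (ψ : A →ₗ[k] k)
    (x : A) : TensorProduct.rid k B (ψ.lTensor B
      (conv ((Algebra.TensorProduct.includeLeft : B →ₐ[k] B ⊗[k] A).toLinearMap ∘ₗ Φ)
        (Algebra.TensorProduct.includeRight : A →ₐ[k] B ⊗[k] A).toLinearMap x)) =
      Φ (dualAct ψ x) := by
  rw [conv_apply, dualAct_apply]
  induction (Coalgebra.comul x : A ⊗[k] A) with
  | zero => simp
  | add x y hx hy => simp only [map_add, hx, hy]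
  | tmul x y => simp

lemma ClosedSubgrp.Normal.exists_conv_eq {H : ClosedSubgrp k A} (hH : H.Normal) {R : Type}
    [CommRing R] [Algebra k R] {f : A →ₐ[k] R} (hf : H.mem f) (g : A →ₐ[k] R) :
    ∃ f', H.mem f' ∧ conv f.toLinearMap g.toLinearMap = conv g.toLinearMap f'.toLinearMap := by
  obtain ⟨f', hf', h⟩ := hH R f (g.comp (HopfAlgebra.antipodeAlgHom k A)) hf
  refine ⟨f', hf', ?_⟩
  rw [ptMul_eq, ptMul_eq] at h
  have h := WithConv.ofConv_injective h
  have key : WithConv.toConv f * WithConv.toConv g = WithConv.toConv g * WithConv.toConv f' := by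
    calc WithConv.toConv f * WithConv.toConv g
      _ = WithConv.toConv g * (WithConv.toConv (g.comp (HopfAlgebra.antipodeAlgHom k A)) *
            WithConv.toConv f) * WithConv.toConv g := by
        rw [← mul_assoc, toConv_mul_antipode, one_mul]
      _ = WithConv.toConv g * WithConv.toConv f' := by
        rw [h, mul_assoc, mul_assoc, antipode_mul_toConv, mul_one]
  exact congrArg (fun q : WithConv (A →ₐ[k] R) ↦ q.ofConv.toLinearMap) key

lemma isSubcomodule_fixedSubmodule {H : ClosedSubgrp k A} (hH : H.Normal) {W' W : Submodule k A}
    (hW' : IsSubcomodule W') (hW : IsSubcomodule W) :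
    IsSubcomodule (fixedSubmodule W' W (H.π : A →ₐ[k] H.B).toLinearMap) := by
  intro ψ w hw
  refine ⟨hW ψ w hw.1, fun φ hφ ↦ ?_⟩
  let i : H.B →ₐ[k] H.B ⊗[k] A := Algebra.TensorProduct.includeLeft
  let g : A →ₐ[k] H.B ⊗[k] A := Algebra.TensorProduct.includeRight
  obtain ⟨_, ⟨h, rfl⟩, hconv⟩ := hH.exists_conv_eq ⟨i, rfl⟩ g
  have h0 : ∀ x ∈ W', conv (scalarExt (H.B ⊗[k] A) φ) g.toLinearMap x = 0 := by
    intro x hx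
    rw [hW'.conv_congr (Ψ := 0) g.toLinearMap (fun y hy ↦ by simp [hφ y hy]) hx, conv_apply]
    simp
  have h1 : conv (conv (scalarExt (H.B ⊗[k] A) φ) (i.comp (H.π : A →ₐ[k] H.B)).toLinearMap)
      g.toLinearMap w = conv (scalarExt (H.B ⊗[k] A) φ) g.toLinearMap w := by
    rw [conv_assoc, hconv, ← conv_assoc]
    exact (hw.2.comp h).conv_eq h0
  have h2 := congrArg (fun t ↦ TensorProduct.rid k H.B (ψ.lTensor H.B t)) h1
  rw [AlgHom.comp_toLinearMap, ← comp_scalarExt i, ← comp_conv, rid_lTensor_conv,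
    rid_lTensor_conv] at h2
  exact h2

lemma ClosedSubgrp.Normal.actsTrivially {H : ClosedSubgrp k A} (hH : H.Normal)
    (hu : IsUnipotentHopf k H.B) : ActsTrivially (H.π : A →ₐ[k] H.B).toLinearMap := by
  intro W' W hW w hw
  have hsub := isSubcomodule_fixedSubmodule hH hW.left hW.right
  have hle : W' ≤ fixedSubmodule W' W (H.π : A →ₐ[k] H.B).toLinearMap := by
    refine fun x hx ↦ ⟨hW.lt.le hx, fun φ hφ ↦ ?_⟩
    rw [hW.left.conv_congr (Ψ := 0) _ (fun y hy ↦ by simp [hφ y hy]) hx, conv_apply, hφ x hx]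
    simp
  rcases hW.eq_or_eq _ hsub hle fun x hx ↦ hx.1 with h | h
  · obtain ⟨x, hx, hx', hfix⟩ := exists_fixesMod_of_isUnipotentHopf hu H.π hW
    exact absurd (h.le ⟨hx, hfix⟩) hx'
  · exact (h.ge hw).2

end Maximality

/-- **Theorem (Sercombe).** Let `G = Spec A` be an affine algebraic group scheme of
finite type over a field `k`.  There exists a unipotent normal closed subgroup scheme
`Rad_u(G)` of `G` containing every unipotent normal closed subgroup scheme of `G`. -/
theorem exists_restricted_unipotent_radical (k A : Type) [Field k] [CommRing A]
    [HopfAlgebra k A] (hft : Algebra.FiniteType k A) :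
    ∃ U : ClosedSubgrp k A, IsRadU U := by
  refine ⟨radSubgrp k A, radSubgrp_normal,
    isUnipotentHopf_of_surjective (radSubgrp k A).π (radSubgrp k A).surj
      fun x hx ↦ Ideal.Quotient.eq_zero_iff_mem.2 hx, ?_⟩
  rintro H hH hu R _ _ _ ⟨g, rfl⟩
  exact (radSubgrp_mem_iff _).2 ((hH.actsTrivially hu).comp g)

end
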